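/- arXiv:2510.20368 — 4 statements merged into one kernel-verified Lean document; each statement's English description precedes it below -/
import Mathlib

section
/- Let (G,u) be a bounded maximum flow instance, f a feasible flow, and r : E → [0,∞] with r_e ≤ u^f_e for all e ∈ E. Then ν(G,r) = ν(G,u^f) if and only if there exists a maximum flow f* of (G,u) (a feasible flow with val(f*) = ν(G,u)) such that f*_e − f*_{rev(e)} ≤ f_e − f_{rev(e)} + r_e for every e ∈ E. Moreover, if ν(G,r) = ν(G,u^f), then for every s–t cut S with u(S,V∖S) = ν(G,u) and every arc e from S to V∖S, one has r_e = u^f_e. -/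
open scoped ENNReal Classical

noncomputable section

/-- A maximum flow instance: a finite directed graph (parallel arcs allowed, no
self-loops) with distinct source `s` and sink `t`, a fixed-point-free reversal
involution on arcs, and capacities in `[0,∞]`. -/
structure FlowInstance (V E : Type) [Fintype V] [Fintype E] [DecidableEq V] where
  tail : E → V
  head : E → V
  s : V
  t : V
  s_ne_t : s ≠ t
  rev : E → E
  rev_rev : ∀ e, rev (rev e) = e
  rev_ne : ∀ e, rev e ≠ e
  tail_rev : ∀ e, tail (rev e) = head e
  head_rev : ∀ e, head (rev e) = tail e
  no_loop : ∀ e, tail e ≠ head e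
  u : E → ℝ≥0∞

namespace FlowInstance

variable {V E : Type} [Fintype V] [Fintype E] [DecidableEq V]

/-- The excess of a node: total inflow minus total outflow. -/
def excess (I : FlowInstance V E) (f : E → ℝ) (i : V) : ℝ :=
  ∑ e ∈ Finset.univ.filter (fun e => I.head e = i), f e -
    ∑ e ∈ Finset.univ.filter (fun e => I.tail e = i), f e

/-- A feasible flow: nonnegative, within capacities, and conserving at every
node other than `s` and `t`. -/
def Feasible (I : FlowInstance V E) (f : E → ℝ) : Prop :=
  (∀ e, 0 ≤ f e) ∧ (∀ e, ENNReal.ofReal (f e) ≤ I.u e) ∧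
    ∀ i, i ≠ I.s → i ≠ I.t → I.excess f i = 0

/-- The value of a flow. -/
def val (I : FlowInstance V E) (f : E → ℝ) : ℝ := -I.excess f I.s

/-- The set of values of feasible flows. -/
def flowValues (I : FlowInstance V E) : Set ℝ := {x | ∃ f, I.Feasible f ∧ I.val f = x}

/-- The maximum flow value `ν(G,u)` (as a real supremum). -/
def maxFlowVal (I : FlowInstance V E) : ℝ := sSup I.flowValues

/-- The instance is bounded if `ν(G,u) < ∞`. -/
def Bounded (I : FlowInstance V E) : Prop := BddAbove I.flowValues

/-- Residual capacities `u^f_e = u_e - f_e + f_{rev e}` of a flow. -/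
def residual (I : FlowInstance V E) (f : E → ℝ) : E → ℝ≥0∞ :=
  fun e => I.u e - ENNReal.ofReal (f e) + ENNReal.ofReal (f (I.rev e))

/-- The instance on the same graph with capacities replaced by `u'`. -/
def withCapacity (I : FlowInstance V E) (u' : E → ℝ≥0∞) : FlowInstance V E :=
  { I with u := u' }

/-- An `s`–`t` cut. -/
def IsCut (I : FlowInstance V E) (S : Finset V) : Prop := I.s ∈ S ∧ I.t ∉ S

/-- The capacity `u(S, V∖S)` of a cut. -/
def cutCap (I : FlowInstance V E) (S : Finset V) : ℝ≥0∞ :=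
  ∑ e ∈ Finset.univ.filter (fun e => I.tail e ∈ S ∧ I.head e ∉ S), I.u e

/-- The total residual capacity `u^f(S, V∖S)` of a cut. -/
def resCutCap (I : FlowInstance V E) (f : E → ℝ) (S : Finset V) : ℝ≥0∞ :=
  ∑ e ∈ Finset.univ.filter (fun e => I.tail e ∈ S ∧ I.head e ∉ S), I.residual f e

/-- A directed path from `x` to `y` through pairwise distinct nodes using only
arcs from `A`. -/
def IsDiPath (I : FlowInstance V E) (A : Set E) (x y : V) : Prop :=
  ∃ (k : ℕ) (v : Fin (k + 1) → V) (es : Fin k → E),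
    v 0 = x ∧ v (Fin.last k) = y ∧ Function.Injective v ∧
    ∀ i : Fin k, es i ∈ A ∧ I.tail (es i) = v i.castSucc ∧ I.head (es i) = v i.succ

/-- `A` contains a directed cycle: a head-to-tail sequence of arcs of `A` through
pairwise distinct nodes returning to its starting node. -/
def HasDiCycle (I : FlowInstance V E) (A : Set E) : Prop :=
  ∃ (k : ℕ) (v : Fin (k + 1) → V) (es : Fin (k + 1) → E),
    Function.Injective v ∧
    ∀ i : Fin (k + 1), es i ∈ A ∧ I.tail (es i) = v i ∧ I.head (es i) = v (i + 1)

/-- The constant `Γ = 4 n²` where `n = |V|`. -/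
def Gamma (I : FlowInstance V E) : ℝ := 4 * (Fintype.card V : ℝ) ^ 2

end FlowInstance

/-- `I'` extends `I`: same node set, same `s` and `t`, the arc set of `I'` contains
that of `I` (via the injection `ι`), with the same endpoints, capacities and
reversal involution on the arcs of `I`. -/
def IsExtension {V E E' : Type} [Fintype V] [Fintype E] [Fintype E'] [DecidableEq V]
    (I : FlowInstance V E) (I' : FlowInstance V E') (ι : E → E') : Prop :=
  Function.Injective ι ∧ I'.s = I.s ∧ I'.t = I.t ∧
    (∀ e, I'.tail (ι e) = I.tail e) ∧ (∀ e, I'.head (ι e) = I.head e) ∧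
    (∀ e, I'.rev (ι e) = ι (I.rev e)) ∧ (∀ e, I'.u (ι e) = I.u e)

namespace FlowInstance

variable {V E : Type} [Fintype V] [Fintype E] [DecidableEq V]

/-- Reindexing a sum by arc reversal. -/
lemma sum_head_rev (I : FlowInstance V E) (P : V → V → Prop) [DecidableRel P] (f : E → ℝ) :
    ∑ e ∈ Finset.univ.filter (fun e => P (I.head e) (I.tail e)), f e =
      ∑ e ∈ Finset.univ.filter (fun e => P (I.tail e) (I.head e)), f (I.rev e) := by
  refine Finset.sum_nbij' I.rev I.rev ?_ ?_ ?_ ?_ ?_ <;>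
    simp [I.rev_rev, I.tail_rev, I.head_rev]

lemma excess_eq_sum_net (I : FlowInstance V E) (f : E → ℝ) (i : V) :
    I.excess f i =
      -∑ e ∈ Finset.univ.filter (fun e => I.tail e = i), (f e - f (I.rev e)) := by
  have h := I.sum_head_rev (fun x _ => x = i) f
  beta_reduce at h
  rw [excess, h, Finset.sum_sub_distrib]
  ring

lemma excess_eq_add_of_net (I : FlowInstance V E) {f g h : E → ℝ}
    (hn : ∀ e, g e - g (I.rev e) = (f e - f (I.rev e)) + (h e - h (I.rev e))) (i : V) :
    I.excess g i = I.excess f i + I.excess h i := by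
  simp only [excess_eq_sum_net, hn, Finset.sum_add_distrib]
  ring

lemma excess_add (I : FlowInstance V E) (f h : E → ℝ) (i : V) :
    I.excess (fun e => f e + h e) i = I.excess f i + I.excess h i :=
  I.excess_eq_add_of_net (fun e => by ring) i

lemma excess_const_mul (I : FlowInstance V E) (c : ℝ) (f : E → ℝ) (i : V) :
    I.excess (fun e => c * f e) i = c * I.excess f i := by
  simp only [excess, ← Finset.mul_sum, mul_sub]

lemma excess_single (I : FlowInstance V E) (a : E) (i : V) :
    I.excess (fun e => if e = a then 1 else 0) i =
      (if I.head a = i then 1 else 0) - (if I.tail a = i then 1 else 0) := by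
  simp [excess]

lemma max_net_sub_max_net (I : FlowInstance V E) {d : E → ℝ}
    (hd : ∀ e, d (I.rev e) = -d e) (e : E) :
    max (d e) 0 - max (d (I.rev e)) 0 = d e := by
  rw [hd]
  rcases le_total 0 (d e) with h | h
  · rw [max_eq_left h, max_eq_right (by linarith), sub_zero]
  · rw [max_eq_right h, max_eq_left (by linarith)]; ring

lemma residual_of_ne_top (I : FlowInstance V E) {f : E → ℝ} (hf : I.Feasible f) {e : E}
    (he : I.u e ≠ ⊤) :
    I.residual f e = ENNReal.ofReal ((I.u e).toReal - f e + f (I.rev e)) := by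
  have h := (ENNReal.ofReal_le_iff_le_toReal he).1 (hf.2.1 e)
  rw [ENNReal.ofReal_add (by linarith) (hf.1 _), ENNReal.ofReal_sub _ (hf.1 _),
    ENNReal.ofReal_toReal he, residual]

lemma residual_of_eq_top (I : FlowInstance V E) (f : E → ℝ) {e : E} (he : I.u e = ⊤) :
    I.residual f e = ⊤ := by
  simp [residual, he]

/-- A flow plus a flow in its residual network is a flow. -/
lemma Feasible.exists_add {I : FlowInstance V E} {f h : E → ℝ} (hf : I.Feasible f)
    (hh : (I.withCapacity (I.residual f)).Feasible h) :
    ∃ g, I.Feasible g ∧ I.val g = I.val f + I.val h ∧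
      ∀ e, g e - g (I.rev e) = (f e - f (I.rev e)) + (h e - h (I.rev e)) := by
  let d : E → ℝ := fun e => (f e - f (I.rev e)) + (h e - h (I.rev e))
  have hd : ∀ e, d (I.rev e) = -d e := fun e => by simp only [d, I.rev_rev]; ring
  have hn := I.max_net_sub_max_net hd
  have hex := I.excess_eq_add_of_net (g := fun e => max (d e) 0) (f := f) (h := h) hn
  refine ⟨fun e => max (d e) 0, ⟨fun e => le_max_right _ _, fun e => ?_, fun i hs ht => ?_⟩,
    ?_, hn⟩
  · by_cases he : I.u e = ⊤
    · simp [he]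
    · have hu := (ENNReal.ofReal_le_iff_le_toReal he).1 (hf.2.1 e)
      have h1 : ENNReal.ofReal (h e) ≤ I.residual f e := hh.2.1 e
      have h2 := hf.1 (I.rev e)
      have h3 := hh.1 (I.rev e)
      rw [I.residual_of_ne_top hf he, ENNReal.ofReal_le_ofReal_iff (by linarith)] at h1
      rw [ENNReal.ofReal_le_iff_le_toReal he]
      refine max_le ?_ ENNReal.toReal_nonneg
      simp only [d]
      linarith
  · rw [hex, hf.2.2 i hs ht, show I.excess h i = 0 from hh.2.2 i hs ht, add_zero]
  · rw [val, hex, val, val]; ring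

/-- The difference of two flows is a flow for all capacities dominating the difference of the
net flows. -/
lemma Feasible.exists_sub {I : FlowInstance V E} {f g : E → ℝ} (hf : I.Feasible f)
    (hg : I.Feasible g) {r : E → ℝ≥0∞}
    (hr : ∀ e, ENNReal.ofReal ((g e - g (I.rev e)) - (f e - f (I.rev e))) ≤ r e) :
    ∃ h, (I.withCapacity r).Feasible h ∧ I.val h = I.val g - I.val f := by
  let d : E → ℝ := fun e => (g e - g (I.rev e)) - (f e - f (I.rev e))
  have hd : ∀ e, d (I.rev e) = -d e := fun e => by simp only [d, I.rev_rev]; ring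
  have hn := I.max_net_sub_max_net hd
  have hex := I.excess_eq_add_of_net (g := g) (f := f) (h := fun e => max (d e) 0)
    (fun e => by rw [hn e]; simp only [d]; ring)
  refine ⟨fun e => max (d e) 0, ⟨fun e => le_max_right _ _, fun e => ?_, fun i hs ht => ?_⟩, ?_⟩
  · simpa [withCapacity, ENNReal.ofReal_max] using hr e
  · have := hex i
    rw [hf.2.2 i hs ht, hg.2.2 i hs ht] at this
    change I.excess _ i = 0
    linarith
  · have := hex I.s
    simp only [val]
    linarith

lemma Feasible.ofReal_net_sub_net_le_residual {I : FlowInstance V E} {f g : E → ℝ}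
    (hf : I.Feasible f) (hg : I.Feasible g) (e : E) :
    ENNReal.ofReal ((g e - g (I.rev e)) - (f e - f (I.rev e))) ≤ I.residual f e := by
  by_cases he : I.u e = ⊤
  · simp [I.residual_of_eq_top f he]
  · rw [I.residual_of_ne_top hf he]
    have hu := (ENNReal.ofReal_le_iff_le_toReal he).1 (hg.2.1 e)
    have := hg.1 (I.rev e)
    exact ENNReal.ofReal_le_ofReal (by linarith)

/-- The value of a flow is the net flow across any cut. -/
lemma Feasible.val_eq_sum_cut {I : FlowInstance V E} {f : E → ℝ} (hf : I.Feasible f)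
    {S : Finset V} (hS : I.IsCut S) :
    I.val f = ∑ e ∈ Finset.univ.filter (fun e => I.tail e ∈ S ∧ I.head e ∉ S),
      (f e - f (I.rev e)) := by
  have h1 : ∑ i ∈ S, I.excess f i = I.excess f I.s :=
    Finset.sum_eq_single_of_mem _ hS.1
      fun i hi hs => hf.2.2 i hs fun ht => hS.2 (ht ▸ hi)
  have h2 := I.sum_head_rev (fun x y => x ∈ S ∧ y ∉ S) f
  beta_reduce at h2
  rw [val, ← h1, Finset.sum_sub_distrib, ← h2]
  simp only [excess, Finset.sum_sub_distrib, Finset.sum_filter]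
  rw [Finset.sum_comm, Finset.sum_comm (s := S)]
  simp only [Finset.sum_ite_eq, ← Finset.sum_sub_distrib, ← Finset.sum_neg_distrib]
  refine Finset.sum_congr rfl fun e _ => ?_
  by_cases ha : I.head e ∈ S <;> by_cases hb : I.tail e ∈ S <;> simp [ha, hb]

lemma Feasible.ofReal_val_le_cutCap {I : FlowInstance V E} {f : E → ℝ} (hf : I.Feasible f)
    {S : Finset V} (hS : I.IsCut S) : ENNReal.ofReal (I.val f) ≤ I.cutCap S := by
  calc ENNReal.ofReal (I.val f)
      ≤ ENNReal.ofReal (∑ e ∈ Finset.univ.filter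
          (fun e => I.tail e ∈ S ∧ I.head e ∉ S), f e) := by
        rw [hf.val_eq_sum_cut hS]
        exact ENNReal.ofReal_le_ofReal
          (Finset.sum_le_sum fun e _ => sub_le_self _ (hf.1 _))
    _ = ∑ e ∈ Finset.univ.filter (fun e => I.tail e ∈ S ∧ I.head e ∉ S),
          ENNReal.ofReal (f e) := ENNReal.ofReal_sum_of_nonneg fun e _ => hf.1 e
    _ ≤ I.cutCap S := Finset.sum_le_sum fun e _ => hf.2.1 e

/-- There is a unit flow to each node reachable from `s` through arcs of `A`. -/
lemma exists_unit_flow_of_reachable (I : FlowInstance V E) (A : Set E) {y : V}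
    (hy : Relation.ReflTransGen (fun a b => ∃ e ∈ A, I.tail e = a ∧ I.head e = b) I.s y) :
    ∃ d : E → ℝ, (∀ e, 0 ≤ d e) ∧ (∀ e, e ∉ A → d e = 0) ∧
      ∀ i, I.excess d i = (if y = i then 1 else 0) - (if I.s = i then 1 else 0) := by
  induction hy with
  | refl => exact ⟨fun _ => 0, by simp, by simp, by simp [excess]⟩
  | @tail b c _ hbc ih =>
    obtain ⟨d, h0, hA, hex⟩ := ih
    obtain ⟨a, ha, rfl, rfl⟩ := hbc
    refine ⟨fun e => d e + if e = a then 1 else 0, fun e => ?_, fun e he => ?_, fun i => ?_⟩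
    · have := h0 e
      positivity
    · beta_reduce
      rw [hA e he, if_neg (by rintro rfl; exact he ha), add_zero]
    · rw [I.excess_add d (fun e => if e = a then 1 else 0), hex, excess_single]
      ring

/-- If `t` is reachable from `s` in the residual graph, the flow can be augmented. -/
lemma Feasible.exists_val_lt {I : FlowInstance V E} {f : E → ℝ} (hf : I.Feasible f)
    (ht : Relation.ReflTransGen
      (fun a b => ∃ e ∈ {e | I.residual f e ≠ 0}, I.tail e = a ∧ I.head e = b) I.s I.t) :
    ∃ g, I.Feasible g ∧ I.val f < I.val g := by
  obtain ⟨d, h0, hA, hex⟩ := I.exists_unit_flow_of_reachable _ ht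
  have hev : ∀ᶠ c in nhdsWithin (0 : ℝ) (Set.Ioi 0),
      ∀ e, ENNReal.ofReal (c * d e) ≤ I.residual f e := by
    rw [Filter.eventually_all]
    intro e
    by_cases he : I.residual f e = 0
    · simp [hA e (by simpa using he)]
    · have hc : Filter.Tendsto (fun c : ℝ => ENNReal.ofReal (c * d e)) (nhds 0) (nhds 0) := by
        have : Continuous fun c : ℝ => ENNReal.ofReal (c * d e) :=
          ENNReal.continuous_ofReal.comp (by fun_prop)
        simpa using this.tendsto 0
      exact ((hc.mono_left nhdsWithin_le_nhds).eventually_lt_const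
        (pos_iff_ne_zero.2 he)).mono fun c hc => hc.le
  obtain ⟨c, hc, hpos⟩ := (hev.and self_mem_nhdsWithin).exists
  have hpos : 0 < c := hpos
  obtain ⟨g, hg, hval, -⟩ := hf.exists_add (h := fun e => c * d e)
    ⟨fun e => mul_nonneg hpos.le (h0 e), hc, fun i hs ht => by
      change I.excess _ i = 0
      rw [excess_const_mul, hex, if_neg (show I.t ≠ i from Ne.symm ht),
        if_neg (show I.s ≠ i from Ne.symm hs)]
      simp⟩
  refine ⟨g, hg, ?_⟩
  rw [hval, val, val, excess_const_mul, hex, if_neg I.s_ne_t.symm, if_pos rfl]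
  linarith

lemma feasible_zero (I : FlowInstance V E) : I.Feasible 0 :=
  ⟨by simp, by simp, by simp [excess]⟩

lemma Feasible.val_le_maxFlowVal {I : FlowInstance V E} (hB : I.Bounded) {f : E → ℝ}
    (hf : I.Feasible f) : I.val f ≤ I.maxFlowVal :=
  le_csSup hB ⟨f, hf, rfl⟩

lemma maxFlowVal_le (I : FlowInstance V E) {c : ℝ} (h : ∀ f, I.Feasible f → I.val f ≤ c) :
    I.maxFlowVal ≤ c :=
  csSup_le ⟨_, 0, I.feasible_zero, rfl⟩ (by rintro _ ⟨f, hf, rfl⟩; exact h f hf)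

lemma maxFlowVal_nonneg {I : FlowInstance V E} (hB : I.Bounded) : 0 ≤ I.maxFlowVal := by
  simpa [val, excess] using I.feasible_zero.val_le_maxFlowVal hB

lemma continuous_excess (I : FlowInstance V E) (i : V) : Continuous fun f => I.excess f i := by
  unfold excess
  fun_prop

lemma isCompact_setOf_feasible (I : FlowInstance V E) (hu : ∀ e, I.u e ≠ ⊤) :
    IsCompact {f | I.Feasible f} := by
  refine (isCompact_Icc (a := (0 : E → ℝ)) (b := fun e => (I.u e).toReal)).of_isClosed_subset
    ?_ fun f hf => ⟨hf.1, fun e => (ENNReal.ofReal_le_iff_le_toReal (hu e)).1 (hf.2.1 e)⟩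
  simp only [Feasible, Set.ofPred_and, Set.ofPred_forall]
  refine .inter (isClosed_iInter fun e => ?_) (.inter (isClosed_iInter fun e => ?_)
    (isClosed_iInter fun i => isClosed_iInter fun _ => isClosed_iInter fun _ => ?_))
  · exact isClosed_le continuous_const (continuous_apply e)
  · exact isClosed_le (ENNReal.continuous_ofReal.comp (continuous_apply e)) continuous_const
  · exact isClosed_eq (I.continuous_excess i) continuous_const

/-- Max-flow min-cut for finite capacities. -/
lemma exists_ofReal_val_eq_cutCap (I : FlowInstance V E) (hu : ∀ e, I.u e ≠ ⊤) :
    ∃ f S, I.Feasible f ∧ 0 ≤ I.val f ∧ I.IsCut S ∧ ENNReal.ofReal (I.val f) = I.cutCap S := by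
  obtain ⟨f, hf, hmax⟩ := (I.isCompact_setOf_feasible hu).exists_isMaxOn
    ⟨0, I.feasible_zero⟩ (f := I.val) (I.continuous_excess I.s).neg.continuousOn
  have hf : I.Feasible f := hf
  let R : V → V → Prop :=
    fun a b => ∃ e ∈ {e | I.residual f e ≠ 0}, I.tail e = a ∧ I.head e = b
  have hS : I.IsCut (Finset.univ.filter (Relation.ReflTransGen R I.s)) := by
    refine ⟨by simpa using Relation.ReflTransGen.refl, fun ht => ?_⟩
    obtain ⟨g, hg, hlt⟩ := hf.exists_val_lt (Finset.mem_filter.1 ht).2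
    exact (hmax hg).not_gt hlt
  refine ⟨f, _, hf, by simpa [val, excess] using hmax I.feasible_zero, hS, ?_⟩
  have hres : ∀ e ∈ Finset.univ.filter (fun e =>
      I.tail e ∈ Finset.univ.filter (Relation.ReflTransGen R I.s) ∧
      I.head e ∉ Finset.univ.filter (Relation.ReflTransGen R I.s)),
      I.residual f e = 0 := by
    intro e he
    simp only [Finset.mem_filter, Finset.mem_univ, true_and] at he
    by_contra h
    exact he.2 (he.1.tail ⟨e, h, rfl, rfl⟩)
  have hsat := fun e he => add_eq_zero.1 (hres e he)
  rw [hf.val_eq_sum_cut hS, cutCap, Finset.sum_congr rfl (g := f) fun e he => by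
      rw [le_antisymm (ENNReal.ofReal_eq_zero.1 (hsat e he).2) (hf.1 _), sub_zero],
    ENNReal.ofReal_sum_of_nonneg fun e _ => hf.1 e]
  exact Finset.sum_congr rfl fun e he =>
    le_antisymm (hf.2.1 e) (tsub_eq_zero_iff_le.1 (hsat e he).1)

lemma Feasible.of_withCapacity {I : FlowInstance V E} {u' : E → ℝ≥0∞} {f : E → ℝ}
    (hf : (I.withCapacity u').Feasible f) (hu : ∀ e, u' e ≤ I.u e) : I.Feasible f :=
  ⟨hf.1, fun e => (hf.2.1 e).trans (hu e), hf.2.2⟩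

/-- A bounded instance has a maximum flow, even if some capacities are infinite. -/
lemma Bounded.exists_val_eq_maxFlowVal {I : FlowInstance V E} (hB : I.Bounded) :
    ∃ f, I.Feasible f ∧ I.val f = I.maxFlowVal := by
  obtain ⟨M, hM⟩ := exists_gt I.maxFlowVal
  obtain ⟨f, S, hf, h0, hS, hval⟩ := (I.withCapacity fun e => min (I.u e) (ENNReal.ofReal M))
    |>.exists_ofReal_val_eq_cutCap fun e => (min_lt_of_right_lt ENNReal.ofReal_lt_top).ne
  have hfI := hf.of_withCapacity fun e => min_le_left _ _
  have hle := hfI.val_le_maxFlowVal hB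
  change 0 ≤ I.val f at h0
  change ENNReal.ofReal (I.val f) = _ at hval
  refine ⟨f, hfI, le_antisymm hle (I.maxFlowVal_le fun g hg => ?_)⟩
  have hlt : ∀ e ∈ Finset.univ.filter (fun e => I.tail e ∈ S ∧ I.head e ∉ S),
      I.u e < ENNReal.ofReal M := by
    intro e he
    by_contra! h
    have h1 : min (I.u e) (ENNReal.ofReal M) ≤ ENNReal.ofReal (I.val f) := by
      rw [hval]
      exact Finset.single_le_sum (f := fun e => min (I.u e) (ENNReal.ofReal M))
        (fun _ _ => zero_le) he
    rw [min_eq_right h] at h1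
    have hpos := (maxFlowVal_nonneg hB).trans_lt hM
    rw [ENNReal.ofReal_le_ofReal_iff'] at h1
    rcases h1 with h1 | h1 <;> linarith
  have hcap : ENNReal.ofReal (I.val f) = I.cutCap S :=
    hval.trans (Finset.sum_congr rfl fun e he => min_eq_left (hlt e he).le)
  have h2 := hg.ofReal_val_le_cutCap hS
  rwa [← hcap, ENNReal.ofReal_le_ofReal_iff h0] at h2

lemma Feasible.bounded_residual {I : FlowInstance V E} (hB : I.Bounded) {f : E → ℝ}
    (hf : I.Feasible f) : (I.withCapacity (I.residual f)).Bounded := by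
  refine ⟨I.maxFlowVal - I.val f, ?_⟩
  rintro _ ⟨h, hh, rfl⟩
  obtain ⟨g, hg, hval, -⟩ := hf.exists_add hh
  have := hg.val_le_maxFlowVal hB
  change I.val h ≤ _
  linarith

lemma Feasible.maxFlowVal_residual {I : FlowInstance V E} (hB : I.Bounded) {f : E → ℝ}
    (hf : I.Feasible f) :
    (I.withCapacity (I.residual f)).maxFlowVal = I.maxFlowVal - I.val f := by
  refine le_antisymm (maxFlowVal_le _ fun h hh => ?_) ?_
  · obtain ⟨g, hg, hval, -⟩ := hf.exists_add hh
    have := hg.val_le_maxFlowVal hB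
    change I.val h ≤ _
    linarith
  · rw [sub_le_iff_le_add]
    refine I.maxFlowVal_le fun g hg => ?_
    obtain ⟨h, hh, hval⟩ := hf.exists_sub hg (hf.ofReal_net_sub_net_le_residual hg)
    have : I.val h ≤ _ := hh.val_le_maxFlowVal (hf.bounded_residual hB)
    linarith

end FlowInstance

lemma EReal.coe_le_coe_add_coe_ennreal_iff {a b : ℝ} {r : ℝ≥0∞} :
    (a : EReal) ≤ (b : EReal) + (r : EReal) ↔ ENNReal.ofReal (a - b) ≤ r := by
  induction r with
  | top => simp
  | coe r =>
    rw [ENNReal.ofReal_le_coe, sub_le_iff_le_add', ← EReal.coe_le_coe_iff]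
    rfl

/-- Safe residual capacities: `ν(G,r) = ν(G,u^f)` iff there is a maximum flow `f*`
with `f*_e - f*_{rev e} ≤ f_e - f_{rev e} + r_e` on every arc; moreover in that
case `r` agrees with `u^f` on every arc crossing a minimum cut. -/
theorem safe_capacity_characterization
    {V E : Type} [Fintype V] [Fintype E] [DecidableEq V]
    (I : FlowInstance V E) (hB : I.Bounded)
    (f : E → ℝ) (hf : I.Feasible f)
    (r : E → ℝ≥0∞) (hr : ∀ e, r e ≤ I.residual f e) :
    ((I.withCapacity r).maxFlowVal = (I.withCapacity (I.residual f)).maxFlowVal ↔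
      ∃ g : E → ℝ, I.Feasible g ∧ I.val g = I.maxFlowVal ∧
        ∀ e, ((g e - g (I.rev e) : ℝ) : EReal) ≤
          ((f e - f (I.rev e) : ℝ) : EReal) + (r e : EReal)) ∧
    ((I.withCapacity r).maxFlowVal = (I.withCapacity (I.residual f)).maxFlowVal →
      ∀ S : Finset V, I.IsCut S → I.cutCap S = ENNReal.ofReal I.maxFlowVal →
        ∀ e, I.tail e ∈ S → I.head e ∉ S → r e = I.residual f e) := by
  simp only [EReal.coe_le_coe_add_coe_ennreal_iff]
  have hres := hf.maxFlowVal_residual hB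
  have hrB : (I.withCapacity r).Bounded :=
    BddAbove.mono (by
      rintro x ⟨h, hh, hx⟩
      exact ⟨h, FlowInstance.Feasible.of_withCapacity
        (I := I.withCapacity (I.residual f)) hh hr, hx⟩) (hf.bounded_residual hB)
  have hforward : (I.withCapacity r).maxFlowVal = (I.withCapacity (I.residual f)).maxFlowVal →
      ∃ g : E → ℝ, I.Feasible g ∧ I.val g = I.maxFlowVal ∧
        ∀ e, ENNReal.ofReal ((g e - g (I.rev e)) - (f e - f (I.rev e))) ≤ r e := by
    intro heq
    obtain ⟨h, hh, hval⟩ := hrB.exists_val_eq_maxFlowVal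
    change I.val h = _ at hval
    obtain ⟨g, hg, hgval, hnet⟩ := hf.exists_add (h := h)
      (FlowInstance.Feasible.of_withCapacity (I := I.withCapacity (I.residual f)) hh hr)
    refine ⟨g, hg, by linarith, fun e => le_trans (ENNReal.ofReal_le_ofReal ?_) (hh.2.1 e)⟩
    have := hh.1 (I.rev e)
    rw [hnet]
    linarith
  refine ⟨⟨hforward, ?_⟩, fun heq S hS hcap e he he' => le_antisymm (hr e) ?_⟩
  · rintro ⟨g, hg, hgval, hnet⟩
    obtain ⟨h, hh, hval⟩ := hf.exists_sub hg hnet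
    refine le_antisymm (FlowInstance.maxFlowVal_le _ fun k hk => ?_) ?_
    · exact FlowInstance.Feasible.val_le_maxFlowVal (hf.bounded_residual hB)
        (FlowInstance.Feasible.of_withCapacity (I := I.withCapacity (I.residual f)) hk hr)
    · rw [hres, ← hgval, ← hval]
      exact hh.val_le_maxFlowVal hrB
  · obtain ⟨g, hg, hgval, hnet⟩ := hforward heq
    have hfin : ∀ a ∈ Finset.univ.filter (fun a => I.tail a ∈ S ∧ I.head a ∉ S),
        I.u a ≠ ⊤ := by
      rw [← ENNReal.sum_ne_top]
      exact hcap.trans_ne ENNReal.ofReal_ne_top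
    have hmem : e ∈ Finset.univ.filter (fun a => I.tail a ∈ S ∧ I.head a ∉ S) := by
      simp [he, he']
    have hsum : ∑ a ∈ Finset.univ.filter (fun a => I.tail a ∈ S ∧ I.head a ∉ S),
        ((I.u a).toReal - (g a - g (I.rev a))) = 0 := by
      rw [Finset.sum_sub_distrib, ← hg.val_eq_sum_cut hS, ← ENNReal.toReal_sum hfin, hgval]
      change (I.cutCap S).toReal - _ = 0
      rw [hcap, ENNReal.toReal_ofReal (FlowInstance.maxFlowVal_nonneg hB), sub_self]
    rw [Finset.sum_eq_zero_iff_of_nonneg fun a ha => by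
      have h1 := (ENNReal.ofReal_le_iff_le_toReal (hfin a ha)).1 (hg.2.1 a)
      have h2 := hg.1 (I.rev a)
      linarith] at hsum
    refine le_trans (le_of_eq ?_) (hnet e)
    rw [I.residual_of_ne_top hf (hfin e hmem)]
    congr 1
    linarith [hsum e hmem]
end
end

section
/- Let (G,u) be a maximum flow instance with n = |V| and Γ := 4n², let f be a feasible flow and r : E → [0,∞]. Let (G',u') be a maximum flow instance on the same node set with the same s and t whose arc set contains E, with u'_e = u_e and the same reversal involution on arcs of E, let ε ≥ 0 and 0 ≤ ε' ≤ Γ^{-3}ε, and let f' be a feasible flow in (G',u') satisfying f'_e − f_e + f_{rev(e)} ≤ min{r_e, ε} + Γ^{-2}ε for every e ∈ E. Then every arc e ∈ E with u^f_e ≥ r_e + 2Γ^{-2}ε and u^f_{rev(e)} ≥ r_{rev(e)} + 2Γ^{-2}ε satisfies u'^{f'}_e ≥ Γε' and u'^{f'}_{rev(e)} ≥ Γε'; that is, every such gap arc is (f',ε')-free. -/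
open scoped ENNReal Classical

noncomputable section

namespace FlowInstance

variable {V E : Type} [Fintype V] [Fintype E] [DecidableEq V]

theorem Gamma_pos (I : FlowInstance V E) : 0 < I.Gamma := by
  have hV : 0 < (Fintype.card V : ℝ) := by
    exact_mod_cast Fintype.card_pos_iff.mpr ⟨I.s⟩
  unfold Gamma
  positivity

theorem residual_eq_top (I : FlowInstance V E) (f : E → ℝ) {e : E} (hu : I.u e = ⊤) :
    I.residual f e = ⊤ := by
  simp [residual, hu]

theorem residual_eq_ofReal (I : FlowInstance V E) {f : E → ℝ} (hf : I.Feasible f) {e : E}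
    (hu : I.u e ≠ ⊤) :
    I.residual f e = ENNReal.ofReal ((I.u e).toReal - f e + f (I.rev e)) := by
  have hle : f e ≤ (I.u e).toReal := (ENNReal.ofReal_le_iff_le_toReal hu).mp (hf.2.1 e)
  rw [residual, ENNReal.ofReal_add (sub_nonneg.mpr hle) (hf.1 _),
    ENNReal.ofReal_sub _ (hf.1 e), ENNReal.ofReal_toReal hu]

end FlowInstance

/-- If the flow `g` on an extension sends along `e` at most `min r c + δ` more than the net
flow of `f`, and the residual capacity of `e` under `f` is at least `r + 2δ`, then its residual
capacity under `g` is at least `δ`. -/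
theorem IsExtension.ofReal_le_residual
    {V E E' : Type} [Fintype V] [Fintype E] [Fintype E'] [DecidableEq V]
    {I : FlowInstance V E} {I' : FlowInstance V E'} {ι : E → E'} (hext : IsExtension I I' ι)
    {f : E → ℝ} (hf : I.Feasible f) {g : E' → ℝ} (hg : I'.Feasible g)
    {r c : ℝ≥0∞} {δ : ℝ} (hδ : 0 ≤ δ) {e : E}
    (hprox : g (ι e) - f e + f (I.rev e) ≤ (min r c).toReal + δ)
    (hgap : r + ENNReal.ofReal (2 * δ) ≤ I.residual f e) :
    ENNReal.ofReal δ ≤ I'.residual g (ι e) := by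
  obtain ⟨-, -, -, -, -, -, hcap⟩ := hext
  by_cases hu : I.u e = ⊤
  · simp [I'.residual_eq_top g ((hcap e).trans hu)]
  rw [I'.residual_eq_ofReal hg (by rwa [hcap]), hcap]
  apply ENNReal.ofReal_le_ofReal
  rw [I.residual_eq_ofReal hf hu] at hgap
  have hr : r ≠ ⊤ := ne_top_of_le_ne_top ENNReal.ofReal_ne_top (le_self_add.trans hgap)
  have hmin : (min r c).toReal ≤ r.toReal := ENNReal.toReal_mono hr (min_le_left _ _)
  have hres : 0 ≤ (I.u e).toReal - f e + f (I.rev e) := by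
    have := (ENNReal.ofReal_le_iff_le_toReal hu).mp (hf.2.1 e)
    linarith [hf.1 (I.rev e)]
  rw [← ENNReal.ofReal_toReal hr, ← ENNReal.ofReal_add ENNReal.toReal_nonneg (by positivity),
    ENNReal.ofReal_le_ofReal_iff hres] at hgap
  linarith [hg.1 (I'.rev (ι e))]

/-- Gap arcs become free: if `f'` is a flow on an extension with
`f'_e - f_e + f_{rev e} ≤ min{r_e,ε} + Γ⁻²ε` on every original arc and
`ε' ≤ Γ⁻³ε`, then every arc with `u^f_e ≥ r_e + 2Γ⁻²ε` and
`u^f_{rev e} ≥ r_{rev e} + 2Γ⁻²ε` is `(f',ε')`-free. -/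
theorem gap_arcs_become_free
    {V E E' : Type} [Fintype V] [Fintype E] [Fintype E'] [DecidableEq V]
    (I : FlowInstance V E) (I' : FlowInstance V E') (ι : E → E')
    (hext : IsExtension I I' ι)
    (f : E → ℝ) (hf : I.Feasible f) (r : E → ℝ≥0∞)
    (ε ε' : ℝ) (hε : 0 ≤ ε) (hε' : 0 ≤ ε') (hle : ε' ≤ ε / I.Gamma ^ 3)
    (g : E' → ℝ) (hg : I'.Feasible g)
    (hprox : ∀ e, g (ι e) - f e + f (I.rev e) ≤
      (min (r e) (ENNReal.ofReal ε)).toReal + ε / I.Gamma ^ 2) :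
    ∀ e, r e + ENNReal.ofReal (2 * (ε / I.Gamma ^ 2)) ≤ I.residual f e →
      r (I.rev e) + ENNReal.ofReal (2 * (ε / I.Gamma ^ 2)) ≤ I.residual f (I.rev e) →
      ENNReal.ofReal (I.Gamma * ε') ≤ I'.residual g (ι e) ∧
      ENNReal.ofReal (I.Gamma * ε') ≤ I'.residual g (ι (I.rev e)) := by
  have hΓ := I.Gamma_pos
  have hδ : 0 ≤ ε / I.Gamma ^ 2 := by positivity
  have hscale : I.Gamma * ε' ≤ ε / I.Gamma ^ 2 := by
    calc I.Gamma * ε' ≤ I.Gamma * (ε / I.Gamma ^ 3) := by gcongr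
      _ = ε / I.Gamma ^ 2 := by field_simp
  intro e he hrev
  exact ⟨(ENNReal.ofReal_le_ofReal hscale).trans (hext.ofReal_le_residual hf hg hδ (hprox e) he),
    (ENNReal.ofReal_le_ofReal hscale).trans
      (hext.ofReal_le_residual hf hg hδ (hprox (I.rev e)) hrev)⟩
end
end

section
/- Let (G,u) be a maximum flow instance and let f be a feasible flow whose support supp(f) := {e ∈ E : f_e ≠ 0} contains no directed cycle and contains no directed path from t to s. Then f_e = 0 for every arc e entering s and for every arc e leaving t. -/
open scoped ENNReal Classical

noncomputable section

namespace FlowInstance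

/-- `x` and `y` are joined by an arc of `A` from `x` to `y`. -/
def ArcRel {V E : Type} [Fintype V] [Fintype E] [DecidableEq V]
    (I : FlowInstance V E) (A : Set E) (x y : V) : Prop :=
  ∃ e ∈ A, I.tail e = x ∧ I.head e = y

theorem isDiPath_of_reflTransGen {V E : Type} [Fintype V] [Fintype E] [DecidableEq V]
    (I : FlowInstance V E) {A : Set E} {x y : V}
    (h : Relation.ReflTransGen (I.ArcRel A) x y) : I.IsDiPath A x y := by
  induction h using Relation.ReflTransGen.head_induction_on with
  | refl =>
    exact ⟨0, fun _ => y, Fin.elim0, rfl, rfl, fun a b _ => Fin.ext (by omega),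
      fun i => i.elim0⟩
  | @head a b hab _ ih =>
    obtain ⟨k, v, es, h0, hl, hinj, hes⟩ := ih
    obtain ⟨e, heA, hta, hhe⟩ := hab
    by_cases ha : ∃ j, v j = a
    · obtain ⟨j, hj⟩ := ha
      have hjk : (j : ℕ) ≤ k := Nat.lt_succ_iff.mp j.isLt
      refine ⟨k - j, fun i => v ⟨j + i, by omega⟩, fun i => es ⟨j + i, by omega⟩,
        ?_, ?_, ?_, ?_⟩
      · simpa using hj
      · rw [← hl]
        exact congrArg v (Fin.ext (by simp only [Fin.val_last]; omega))
      · intro p q hpq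
        have := congrArg Fin.val (hinj hpq)
        ext
        simpa using this
      · intro i
        exact hes ⟨j + i, by omega⟩
    · refine ⟨k + 1, Fin.cons a v, Fin.cons e es, rfl, ?_, ?_, ?_⟩
      · rw [← Fin.succ_last, Fin.cons_succ, hl]
      · exact Fin.cons_injective_iff.mpr ⟨ha, hinj⟩
      · intro i
        refine Fin.cases ?_ (fun i => ?_) i
        · refine ⟨heA, hta, ?_⟩
          rw [Fin.cons_zero, Fin.cons_succ, hhe, h0]
        · simpa [← Fin.succ_castSucc] using hes i

theorem hasDiCycle_of_transGen {V E : Type} [Fintype V] [Fintype E] [DecidableEq V]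
    (I : FlowInstance V E) {A : Set E} {x : V}
    (h : Relation.TransGen (I.ArcRel A) x x) : I.HasDiCycle A := by
  obtain ⟨y, ⟨e, heA, hte, hhe⟩, hyx⟩ := Relation.TransGen.head'_iff.mp h
  obtain ⟨k, v, es, h0, hl, hinj, hes⟩ := I.isDiPath_of_reflTransGen hyx
  refine ⟨k, v, Fin.snoc es e, hinj, fun i => ?_⟩
  refine Fin.lastCases ?_ (fun i => ?_) i
  · simp [heA, hte, hhe, h0, hl]
  · simpa [Fin.coeSucc_eq_succ] using hes i

theorem wellFounded_transGen_arcRel {V E : Type} [Fintype V] [Fintype E] [DecidableEq V]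
    (I : FlowInstance V E) {A : Set E} (hA : ¬ I.HasDiCycle A) :
    WellFounded (Relation.TransGen (I.ArcRel A)) ∧
      WellFounded (Function.swap (Relation.TransGen (I.ArcRel A))) := by
  have hirr : Std.Irrefl (Relation.TransGen (I.ArcRel A)) :=
    ⟨fun _ h => hA (I.hasDiCycle_of_transGen h)⟩
  have hirr' : Std.Irrefl (Function.swap (Relation.TransGen (I.ArcRel A))) :=
    ⟨fun _ h => hA (I.hasDiCycle_of_transGen h)⟩
  have htr : IsTrans V (Function.swap (Relation.TransGen (I.ArcRel A))) :=
    ⟨fun _ _ _ h h' => Relation.TransGen.trans h' h⟩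
  exact ⟨Finite.wellFounded_of_trans_of_irrefl _, Finite.wellFounded_of_trans_of_irrefl _⟩

/-- At a conserving node, some arc enters with nonzero flow iff some arc leaves with
nonzero flow. -/
theorem Feasible.exists_in_iff_exists_out {V E : Type} [Fintype V] [Fintype E]
    [DecidableEq V] {I : FlowInstance V E} {f : E → ℝ} (hf : I.Feasible f) {x : V}
    (hs : x ≠ I.s) (ht : x ≠ I.t) :
    (∃ e, I.head e = x ∧ f e ≠ 0) ↔ ∃ e, I.tail e = x ∧ f e ≠ 0 := by
  have hx := sub_eq_zero.mp (hf.2.2 x hs ht)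
  have hin := Finset.sum_eq_zero_iff_of_nonneg
    (s := Finset.univ.filter fun e => I.head e = x) fun e _ => hf.1 e
  have hout := Finset.sum_eq_zero_iff_of_nonneg
    (s := Finset.univ.filter fun e => I.tail e = x) fun e _ => hf.1 e
  rw [hx] at hin
  have := hin.symm.trans hout
  simp only [Finset.mem_filter, Finset.mem_univ, true_and] at this
  rw [← not_iff_not]
  push Not
  exact this

end FlowInstance

/-- If the support of a feasible flow contains no directed cycle and no directed
path from `t` to `s`, then `f` vanishes on every arc entering `s` and on every
arc leaving `t`. -/
theorem flow_zero_into_source_out_of_sink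
    {V E : Type} [Fintype V] [Fintype E] [DecidableEq V]
    (I : FlowInstance V E)
    (f : E → ℝ) (hf : I.Feasible f)
    (hcyc : ¬ I.HasDiCycle {e | f e ≠ 0})
    (hts : ¬ I.IsDiPath {e | f e ≠ 0} I.t I.s) :
    (∀ e, I.head e = I.s → f e = 0) ∧ (∀ e, I.tail e = I.t → f e = 0) := by
  obtain ⟨hwf, hwf'⟩ := I.wellFounded_transGen_arcRel hcyc
  have hts' : ¬ Relation.ReflTransGen (I.ArcRel {e | f e ≠ 0}) I.t I.s :=
    fun h => hts (I.isDiPath_of_reflTransGen h)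
  constructor
  · intro e he
    by_contra hfe
    obtain ⟨x, hx, hmin⟩ := hwf.has_min
      {x | Relation.ReflTransGen (I.ArcRel {e | f e ≠ 0}) x I.s} ⟨I.s, .refl⟩
    have hno : ¬ ∃ a, I.head a = x ∧ f a ≠ 0 := by
      rintro ⟨a, ha, hfa⟩
      have hax : I.ArcRel {e | f e ≠ 0} (I.tail a) x := ⟨a, hfa, rfl, ha⟩
      exact hmin _ (.head hax hx) (.single hax)
    have hxs : x ≠ I.s := fun h => hno ⟨e, he.trans h.symm, hfe⟩
    have hxt : x ≠ I.t := fun h => hts' (h ▸ hx)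
    obtain h | ⟨y, ⟨a, hfa, hta, -⟩, -⟩ := Relation.ReflTransGen.cases_head hx
    · exact hxs h
    · exact hno ((hf.exists_in_iff_exists_out hxs hxt).mpr ⟨a, hta, hfa⟩)
  · intro e he
    by_contra hfe
    obtain ⟨x, hx, hmax⟩ := hwf'.has_min
      {x | Relation.ReflTransGen (I.ArcRel {e | f e ≠ 0}) I.t x} ⟨I.t, .refl⟩
    have hno : ¬ ∃ a, I.tail a = x ∧ f a ≠ 0 := by
      rintro ⟨a, ha, hfa⟩
      have hxa : I.ArcRel {e | f e ≠ 0} x (I.head a) := ⟨a, hfa, ha, rfl⟩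
      exact hmax _ (.tail hx hxa) (.single hxa)
    have hxt : x ≠ I.t := fun h => hno ⟨e, he.trans h.symm, hfe⟩
    have hxs : x ≠ I.s := fun h => hts' (h ▸ hx)
    obtain h | ⟨y, -, ⟨a, hfa, -, hha⟩⟩ := Relation.ReflTransGen.cases_tail hx
    · exact hxt h
    · exact hno ((hf.exists_in_iff_exists_out hxs hxt).mp ⟨a, hha, hfa⟩)
end
end

section
/- Let (G,u) be a bounded maximum flow instance and let f be a feasible flow. Then there exists a feasible flow f̄ that is an extreme point of FlowP(G,u), whose support contains no directed cycle, and which satisfies supp(f̄) ⊆ supp(f) and val(f̄) ≥ val(f). -/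
open scoped ENNReal Classical

noncomputable section

namespace FlowInstance

variable {V E : Type} [Fintype V] [Fintype E] [DecidableEq V]

theorem excess_add_smul (I : FlowInstance V E) (f d : E → ℝ) (t : ℝ) (i : V) :
    I.excess (f + t • d) i = I.excess f i + t * I.excess d i := by
  simp only [excess, Pi.add_apply, Pi.smul_apply, smul_eq_mul, Finset.sum_add_distrib,
    ← Finset.mul_sum]
  ring

theorem val_add_smul (I : FlowInstance V E) (f d : E → ℝ) (t : ℝ) :
    I.val (f + t • d) = I.val f + t * I.val d := by
  simp only [val, excess_add_smul]
  ring

/-- Moving from a feasible flow along a conserving direction that is blocked by some bound,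
there is a step after which the flow is feasible and one of the blocking bounds is tight. -/
theorem exists_blocking_step (I : FlowInstance V E) {g d : E → ℝ} (hg : I.Feasible g)
    (hd : ∀ i, i ≠ I.s → i ≠ I.t → I.excess d i = 0)
    (hb : ∃ e, d e < 0 ∨ (0 < d e ∧ I.u e ≠ ⊤)) :
    ∃ t : ℝ, 0 ≤ t ∧ I.Feasible (g + t • d) ∧
      ∃ e, (d e < 0 ∧ (g + t • d) e = 0) ∨
        (0 < d e ∧ ENNReal.ofReal ((g + t • d) e) = I.u e) := by
  obtain ⟨hg0, hgu, hgc⟩ := hg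
  have hcap : ∀ e, I.u e ≠ ⊤ → g e ≤ (I.u e).toReal := fun e he =>
    (ENNReal.ofReal_le_iff_le_toReal he).1 (hgu e)
  set r : E → ℝ := fun e => if d e < 0 then g e / -d e else ((I.u e).toReal - g e) / d e
  obtain ⟨e₀, he₀, hmin⟩ := Finset.exists_min_image
    (Finset.univ.filter fun e => d e < 0 ∨ (0 < d e ∧ I.u e ≠ ⊤)) r
    (hb.imp fun e he => by simpa using he)
  simp only [Finset.mem_filter, Finset.mem_univ, true_and] at he₀ hmin
  have hr0 : 0 ≤ r e₀ := by
    rcases he₀ with h | ⟨h, hu⟩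
    · simp only [r, if_pos h]
      exact div_nonneg (hg0 _) (by linarith)
    · simp only [r, if_neg h.not_gt]
      exact div_nonneg (by linarith [hcap _ hu]) h.le
  refine ⟨r e₀, hr0, ⟨fun e => ?_, fun e => ?_, fun i hs ht => ?_⟩, e₀, ?_⟩
  · simp only [Pi.add_apply, Pi.smul_apply, smul_eq_mul]
    rcases lt_or_ge (d e) 0 with h | h
    · have := hmin e (Or.inl h)
      rw [show r e = g e / -d e from if_pos h, le_div_iff₀ (by linarith)] at this
      linarith
    · have := mul_nonneg hr0 h
      linarith [hg0 e]
  · by_cases hu : I.u e = ⊤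
    · simp [hu]
    rw [ENNReal.ofReal_le_iff_le_toReal hu]
    simp only [Pi.add_apply, Pi.smul_apply, smul_eq_mul]
    rcases lt_or_ge 0 (d e) with h | h
    · have := hmin e (Or.inr ⟨h, hu⟩)
      rw [show r e = ((I.u e).toReal - g e) / d e from if_neg h.not_gt,
        le_div_iff₀ h] at this
      linarith
    · have := mul_nonpos_of_nonneg_of_nonpos hr0 h
      linarith [hcap e hu]
  · rw [excess_add_smul, hgc i hs ht, hd i hs ht]
    ring
  · simp only [Pi.add_apply, Pi.smul_apply, smul_eq_mul]
    rcases he₀ with h | ⟨h, hu⟩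
    · refine Or.inl ⟨h, ?_⟩
      rw [show r e₀ = g e₀ / -d e₀ from if_pos h]
      have := h.ne
      field_simp
      ring
    · refine Or.inr ⟨h, ?_⟩
      rw [show r e₀ = ((I.u e₀).toReal - g e₀) / d e₀ from if_neg h.not_gt,
        div_mul_cancel₀ _ h.ne', add_sub_cancel, ENNReal.ofReal_toReal hu]

/-- In a bounded instance, an unblocked conserving direction does not increase the value. -/
theorem Bounded.val_nonpos {I : FlowInstance V E} (hB : I.Bounded) {g d : E → ℝ}
    (hg : I.Feasible g) (hd : ∀ i, i ≠ I.s → i ≠ I.t → I.excess d i = 0)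
    (hd0 : ∀ e, 0 ≤ d e) (hdu : ∀ e, 0 < d e → I.u e = ⊤) : I.val d ≤ 0 := by
  obtain ⟨B, hB⟩ := hB
  have hfeas : ∀ t : ℝ, 0 ≤ t → I.Feasible (g + t • d) := by
    refine fun t ht => ⟨fun e => ?_, fun e => ?_, fun i hs ht => ?_⟩
    · simp only [Pi.add_apply, Pi.smul_apply, smul_eq_mul]
      have := mul_nonneg ht (hd0 e)
      linarith [hg.1 e]
    · rcases (hd0 e).eq_or_lt with h | h
      · simpa [← h] using hg.2.1 e
      · simp [hdu e h]
    · rw [excess_add_smul, hg.2.2 i hs ht, hd i hs ht]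
      ring
  by_contra! hpos
  have hle : I.val g ≤ B := hB ⟨g, hg, rfl⟩
  have ht : 0 ≤ (B - I.val g + 1) / I.val d := div_nonneg (by linarith) hpos.le
  have := hB ⟨_, hfeas _ ht, rfl⟩
  rw [val_add_smul, div_mul_cancel₀ _ hpos.ne'] at this
  linarith

/-- The number of times each arc is used by a finite family of arcs. -/
def arcCount {n : ℕ} (es : Fin n → E) (e : E) : ℝ := ∑ k, if es k = e then 1 else 0

theorem excess_arcCount (I : FlowInstance V E) {n : ℕ} (es : Fin n → E) (i : V) :
    I.excess (arcCount es) i =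
      (∑ k, if I.head (es k) = i then (1 : ℝ) else 0) -
        ∑ k, if I.tail (es k) = i then (1 : ℝ) else 0 := by
  have key : ∀ p : E → V, ∑ e ∈ Finset.univ.filter (fun e => p e = i), arcCount es e =
      ∑ k, if p (es k) = i then (1 : ℝ) else 0 := by
    intro p
    simp only [arcCount]
    rw [Finset.sum_comm]
    refine Finset.sum_congr rfl fun k _ => ?_
    rw [Finset.sum_ite_eq]
    simp
  rw [excess, key, key]

/-- A feasible flow whose support contains a directed cycle can be replaced by one of the same
value and strictly smaller support. -/
theorem exists_support_ssubset_of_hasDiCycle (I : FlowInstance V E) {g : E → ℝ}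
    (hg : I.Feasible g) (hc : I.HasDiCycle {e | g e ≠ 0}) :
    ∃ h, I.Feasible h ∧ I.val h = I.val g ∧ {e | h e ≠ 0} ⊂ {e | g e ≠ 0} := by
  obtain ⟨k, v, es, -, hes⟩ := hc
  have hex : ∀ i, I.excess (arcCount es) i = 0 := by
    intro i
    rw [excess_arcCount, sub_eq_zero]
    simp only [(hes _).2.1, (hes _).2.2]
    exact Equiv.sum_comp (Equiv.addRight (1 : Fin (k + 1))) fun j => if v j = i then (1 : ℝ) else 0
  have hneg : -arcCount es = 0 + (-1 : ℝ) • arcCount es := by simp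
  have hex' : ∀ i, I.excess (-arcCount es) i = 0 := by
    intro i
    rw [hneg, excess_add_smul, hex]
    simp [excess]
  have hnonneg : ∀ e, 0 ≤ arcCount es e := fun e =>
    Finset.sum_nonneg fun j _ => by split_ifs <;> norm_num
  have hzero : ∀ e, g e = 0 → arcCount es e = 0 := by
    refine fun e he => Finset.sum_eq_zero fun j _ => if_neg ?_
    rintro rfl
    exact (hes j).1 he
  have hpos : 0 < arcCount es (es 0) :=
    Finset.sum_pos' (fun j _ => by split_ifs <;> norm_num) ⟨0, Finset.mem_univ _, by simp⟩
  obtain ⟨t, -, hfeas, e, he⟩ := I.exists_blocking_step hg (fun i _ _ => hex' i)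
    ⟨es 0, Or.inl (by simpa using hpos)⟩
  refine ⟨_, hfeas, by rw [val_add_smul]; simp [val, hex'], ?_⟩
  have hsub : {e | (g + t • -arcCount es) e ≠ 0} ⊆ {e | g e ≠ 0} :=
    fun e he hge => he (by simp [hge, hzero e hge])
  rw [Set.ssubset_iff_of_subset hsub]
  rcases he with ⟨hlt, h0⟩ | ⟨hlt, -⟩
  · refine ⟨e, fun hge => ?_, not_not.2 h0⟩
    simp [hzero e hge] at hlt
  · exact absurd (hnonneg e) (by simpa using hlt)

/-- The arcs whose flow is strictly between zero and the capacity. -/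
def freeArcs (I : FlowInstance V E) (g : E → ℝ) : Set E :=
  {e | g e ≠ 0 ∧ ENNReal.ofReal (g e) ≠ I.u e}

/-- A conserving direction supported on the free arcs of a flow either can be followed without
decreasing the value, or its opposite can, until a bound becomes tight. -/
theorem Bounded.exists_freeArcs_ssubset {I : FlowInstance V E} (hB : I.Bounded)
    {g d : E → ℝ} (hg : I.Feasible g)
    (hd : ∀ i, i ≠ I.s → i ≠ I.t → I.excess d i = 0)
    (hdg : ∀ e, d e ≠ 0 → e ∈ I.freeArcs g) (hd0 : d ≠ 0) :
    ∃ h, I.Feasible h ∧ I.val g ≤ I.val h ∧ {e | h e ≠ 0} ⊆ {e | g e ≠ 0} ∧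
      I.freeArcs h ⊂ I.freeArcs g := by
  have hneg : -d = 0 + (-1 : ℝ) • d := by simp
  have hdn : ∀ i, i ≠ I.s → i ≠ I.t → I.excess (-d) i = 0 := by
    intro i hs ht
    rw [hneg, excess_add_smul, hd i hs ht]
    simp [excess]
  have hvn : I.val (-d) = -I.val d := by
    rw [hneg, val_add_smul]
    simp [val, excess]
  have step : ∀ d' : E → ℝ, (∀ i, i ≠ I.s → i ≠ I.t → I.excess d' i = 0) →
      (∀ e, d' e ≠ 0 → e ∈ I.freeArcs g) → 0 ≤ I.val d' →
      (∃ e, d' e < 0 ∨ (0 < d' e ∧ I.u e ≠ ⊤)) →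
      ∃ h, I.Feasible h ∧ I.val g ≤ I.val h ∧ {e | h e ≠ 0} ⊆ {e | g e ≠ 0} ∧
        I.freeArcs h ⊂ I.freeArcs g := by
    intro d' hd' hdg' hv hb
    obtain ⟨t, ht, hfeas, e, he⟩ := I.exists_blocking_step hg hd' hb
    have hfix : ∀ e, e ∉ I.freeArcs g → (g + t • d') e = g e := by
      intro e he
      simp [not_not.1 (mt (hdg' e) he)]
    refine ⟨_, hfeas, ?_, fun e he hge => he ?_, ?_⟩
    · rw [val_add_smul]
      linarith [mul_nonneg ht hv]
    · rw [hfix e fun h => h.1 hge, hge]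
    · rw [Set.ssubset_iff_of_subset fun e he => ?_]
      · refine ⟨e, hdg' e ?_, fun h => ?_⟩
        · rcases he with he | he
          exacts [he.1.ne, he.1.ne']
        · rcases he with he | he
          exacts [h.1 he.2, h.2 he.2]
      · by_contra hne
        rw [freeArcs, Set.mem_ofPred_eq, hfix e hne] at he
        exact hne he
  have main : ∀ d' : E → ℝ, (∀ i, i ≠ I.s → i ≠ I.t → I.excess d' i = 0) →
      (∀ i, i ≠ I.s → i ≠ I.t → I.excess (-d') i = 0) → I.val (-d') = -I.val d' →
      (∀ e, d' e ≠ 0 → e ∈ I.freeArcs g) → d' ≠ 0 → 0 ≤ I.val d' →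
      ∃ h, I.Feasible h ∧ I.val g ≤ I.val h ∧ {e | h e ≠ 0} ⊆ {e | g e ≠ 0} ∧
        I.freeArcs h ⊂ I.freeArcs g := by
    intro d' hd' hdn' hvn' hdg' hd0' hv
    by_cases hb : ∃ e, d' e < 0 ∨ (0 < d' e ∧ I.u e ≠ ⊤)
    · exact step d' hd' hdg' hv hb
    · push Not at hb
      have hle := hB.val_nonpos hg hd' (fun e => (hb e).1) fun e => (hb e).2
      obtain ⟨e, he⟩ := Function.ne_iff.1 hd0'
      refine step (-d') hdn' (fun e he => hdg' e (by simpa using he)) (by linarith)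
        ⟨e, Or.inl ?_⟩
      simpa using lt_of_le_of_ne (hb e).1 (Ne.symm he)
  rcases le_total 0 (I.val d) with hv | hv
  · exact main d hd hdn hvn hdg hd0 hv
  · exact main (-d) hdn (by simpa using hd) (by simp [hvn])
      (fun e he => hdg e (by simpa using he)) (by simpa using hd0) (by linarith)

/-- Two feasible flows with a feasible flow strictly between them differ only on free arcs
of the latter. -/
theorem mem_freeArcs_of_mem_openSegment (I : FlowInstance V E) {g x y : E → ℝ}
    (hx : I.Feasible x) (hy : I.Feasible y) (hg : g ∈ openSegment ℝ x y) {e : E}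
    (hne : x e ≠ y e) : e ∈ I.freeArcs g := by
  obtain ⟨a, b, ha, hb, hab, rfl⟩ := hg
  have hx0 := hx.1 e
  have hy0 := hy.1 e
  simp only [freeArcs, Set.mem_ofPred_eq, Pi.add_apply, Pi.smul_apply, smul_eq_mul]
  obtain rfl : b = 1 - a := by linarith
  have hax := mul_nonneg ha.le hx0
  have hby := mul_nonneg hb.le hy0
  refine ⟨fun h => hne ?_, fun h => hne ?_⟩
  · have h1 : x e = 0 := by
      have : a * x e = 0 := by linarith
      simpa [ha.ne'] using this
    have h2 : y e = 0 := by
      have : (1 - a) * y e = 0 := by linarith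
      simpa [hb.ne'] using this
    rw [h1, h2]
  · have hxu := hx.2.1 e
    have hyu := hy.2.1 e
    rw [← h, ENNReal.ofReal_le_ofReal_iff (by linarith)] at hxu hyu
    nlinarith

end FlowInstance

/-- Every feasible flow of a bounded instance can be converted into a basic
(extreme point) flow with acyclic support, supported within the original
support and of at least the original value. -/
theorem exists_basic_acyclic_flow
    {V E : Type} [Fintype V] [Fintype E] [DecidableEq V]
    (I : FlowInstance V E) (hB : I.Bounded)
    (f : E → ℝ) (hf : I.Feasible f) :
    ∃ g : E → ℝ, I.Feasible g ∧
      g ∈ Set.extremePoints ℝ {h : E → ℝ | I.Feasible h} ∧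
      ¬ I.HasDiCycle {e | g e ≠ 0} ∧
      {e | g e ≠ 0} ⊆ {e | f e ≠ 0} ∧
      I.val f ≤ I.val g := by
  let μ : (E → ℝ) → ℕ ×ₗ ℕ := fun g =>
    toLex ({e | g e ≠ 0}.ncard, (I.freeArcs g).ncard)
  obtain ⟨g, ⟨hg, hsupp, hval⟩, hmin⟩ := WellFounded.has_min
    (InvImage.wf μ wellFounded_lt)
    {g | I.Feasible g ∧ {e | g e ≠ 0} ⊆ {e | f e ≠ 0} ∧ I.val f ≤ I.val g}
    ⟨f, hf, subset_rfl, le_rfl⟩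
  refine ⟨g, hg, mem_extremePoints_iff_left.2 ⟨hg, fun x hx y hy hgxy => ?_⟩, fun hc => ?_,
    hsupp, hval⟩
  · by_contra hne
    have hxy : x - y ≠ 0 := by
      rw [sub_ne_zero]
      rintro rfl
      rw [openSegment_same] at hgxy
      exact hne hgxy.symm
    have hcons : ∀ i, i ≠ I.s → i ≠ I.t → I.excess (x - y) i = 0 := by
      intro i hs ht
      rw [show x - y = x + (-1 : ℝ) • y by simp [sub_eq_add_neg], I.excess_add_smul,
        hx.2.2 i hs ht, hy.2.2 i hs ht]
      ring
    obtain ⟨h, hh, hv, hs, hfree⟩ := hB.exists_freeArcs_ssubset hg hcons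
      (fun e he => I.mem_freeArcs_of_mem_openSegment hx hy hgxy (by simpa [sub_eq_zero] using he))
      hxy
    refine hmin h ⟨hh, hs.trans hsupp, hval.trans hv⟩ (Prod.Lex.toLex_lt_toLex'.2 ⟨?_, fun _ => ?_⟩)
    · exact Set.ncard_le_ncard hs
    · exact Set.ncard_lt_ncard hfree
  · obtain ⟨h, hh, hv, hs⟩ := I.exists_support_ssubset_of_hasDiCycle hg hc
    exact hmin h ⟨hh, hs.subset.trans hsupp, hval.trans hv.ge⟩
      (Prod.Lex.toLex_lt_toLex.2 (Or.inl (Set.ncard_lt_ncard hs)))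
end
end
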